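/- There exists a Legendre pair (A, B) of length 133 such that moreover the sets I_A = {i ∈ ℤ_133 : a_i = 1} and I_B = {i ∈ ℤ_133 : b_i = 1} are each invariant under multiplication by 11 modulo 133 (so that the multiplier group of each sequence contains the order-3 subgroup {1, 11, 121} of ℤ_133*). -/

import Mathlib

/-- The periodic autocorrelation function of a sequence indexed by `ℤ_ℓ`:
`PAF(A,s) = ∑_{i} a_i a_{i+s}`. -/
def paf (ℓ : ℕ) [NeZero ℓ] (a : ZMod ℓ → ℤ) (s : ZMod ℓ) : ℤ :=
  ∑ i : ZMod ℓ, a i * a (i + s)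

/-- Two `±1` sequences indexed by `ℤ_ℓ` with entry sums equal to 1 form a Legendre pair
if `PAF(A,s) + PAF(B,s) = -2` for all `s = 1, …, (ℓ-1)/2`. -/
def IsLegendrePair (ℓ : ℕ) [NeZero ℓ] (a b : ZMod ℓ → ℤ) : Prop :=
  (∀ i, a i = 1 ∨ a i = -1) ∧
  (∀ i, b i = 1 ∨ b i = -1) ∧
  (∑ i : ZMod ℓ, a i = 1) ∧
  (∑ i : ZMod ℓ, b i = 1) ∧
  (∀ s : ℕ, 1 ≤ s → s ≤ (ℓ - 1) / 2 → paf ℓ a (s : ZMod ℓ) + paf ℓ b (s : ZMod ℓ) = -2)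

/-- The `±1` sequence of length `ℓ` whose entry at `i` is `1` exactly when bit `i` of `m` is set. -/
def signSeq (ℓ m : ℕ) (i : ZMod ℓ) : ℤ :=
  if m.testBit i.val then 1 else -1

theorem signSeq_eq_one_or (ℓ m : ℕ) (i : ZMod ℓ) : signSeq ℓ m i = 1 ∨ signSeq ℓ m i = -1 := by
  unfold signSeq
  split <;> simp

theorem image_mul_left_eq_of_forall_iff {G : Type*} [Monoid G] (u : Gˣ) {p : G → Prop}
    (h : ∀ i, p (u * i) ↔ p i) : (fun i => (u : G) * i) '' {i | p i} = {i | p i} := by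
  ext j
  refine ⟨?_, fun hj => ⟨↑u⁻¹ * j, ?_, u.mul_inv_cancel_left j⟩⟩
  · rintro ⟨i, hi, rfl⟩
    exact (h i).2 hi
  · exact (h _).1 (by simpa using hj)

/-- The multiplier `11` modulo `133`, which has order 3. -/
def elevenUnit : (ZMod 133)ˣ := ⟨11, 121, by decide, by decide⟩

/-- The bits of the first sequence of a Legendre pair of length 133. -/
def legendreBitsA : ℕ := 99931159477252534937428427744115804747

/-- The bits of the second sequence of a Legendre pair of length 133. -/
def legendreBitsB : ℕ := 8938848285552855848597483906211346026601

theorem isLegendrePair_signSeq_133 :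
    IsLegendrePair 133 (signSeq 133 legendreBitsA) (signSeq 133 legendreBitsB) := by
  refine ⟨signSeq_eq_one_or _ _, signSeq_eq_one_or _ _, by decide +kernel, by decide +kernel, ?_⟩
  have key : ∀ s ∈ Finset.Icc (1 : ℕ) 66, paf 133 (signSeq 133 legendreBitsA) (s : ZMod 133) +
      paf 133 (signSeq 133 legendreBitsB) (s : ZMod 133) = -2 := by
    decide +kernel
  exact fun s hs hs' => key s (Finset.mem_Icc.2 ⟨hs, hs'⟩)

/-- There exists a Legendre pair `(A,B)` of length 133 such that the sets
`I_A = {i : a_i = 1}` and `I_B = {i : b_i = 1}` are each invariant under multiplication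
by 11 modulo 133 (so the multiplier group of each sequence contains the order-3
subgroup {1, 11, 121} of `ℤ_133*`). -/
theorem legendre_pair_133_exists :
    ∃ a b : ZMod 133 → ℤ, IsLegendrePair 133 a b ∧
      (fun i => (11 : ZMod 133) * i) '' {i | a i = 1} = {i | a i = 1} ∧
      (fun i => (11 : ZMod 133) * i) '' {i | b i = 1} = {i | b i = 1} := by
  refine ⟨signSeq 133 legendreBitsA, signSeq 133 legendreBitsB, isLegendrePair_signSeq_133,
    image_mul_left_eq_of_forall_iff elevenUnit (p := fun i => signSeq 133 legendreBitsA i = 1) ?_,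
    image_mul_left_eq_of_forall_iff elevenUnit (p := fun i => signSeq 133 legendreBitsB i = 1) ?_⟩
  · decide +kernel
  · decide +kernel
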